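/- For every positive integer m, the set S(m) decomposes into finitely many orbits under left multiplication by Γ = Sp₄(ℤ); that is, the quotient Γ\S(m) is finite. -/

import Mathlib

open Matrix

noncomputable section

/-- The standard symplectic form matrix `J = ((0, I₂), (−I₂, 0))`. -/
def Jmat : Matrix (Fin 4) (Fin 4) ℝ := !![0, 0, 1, 0; 0, 0, 0, 1; -1, 0, 0, 0; 0, -1, 0, 0]

/-- `Sp₄(ℝ)`: real matrices with `Mᵀ J M = J`. -/
def Sp4 : Set (Matrix (Fin 4) (Fin 4) ℝ) := {M | Mᵀ * Jmat * M = Jmat}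

/-- `S(m)`: integral matrices with `Mᵀ J M = m·J`. -/
def Smat (m : ℕ) : Set (Matrix (Fin 4) (Fin 4) ℤ) :=
  {M | (M.map (Int.cast : ℤ → ℝ))ᵀ * Jmat * (M.map (Int.cast : ℤ → ℝ)) = (m : ℝ) • Jmat}

/-- `K = Sp₄(ℝ) ∩ O(4)`. -/
def Ksp : Set (Matrix (Fin 4) (Fin 4) ℝ) := {k | k ∈ Sp4 ∧ kᵀ * k = 1}

/-- `𝒮(g)_δ[m]`: the elements `γ ∈ S(m)` with `m^(−1/2) γ` within `δ` (entrywise)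
of `g K g⁻¹`. -/
def Sball (g : Matrix (Fin 4) (Fin 4) ℝ) (δ : ℝ) (m : ℕ) :
    Set (Matrix (Fin 4) (Fin 4) ℤ) :=
  {γ | γ ∈ Smat m ∧ ∃ k ∈ Ksp, ∀ i j,
    |(m : ℝ) ^ (-(1 : ℝ)/2) * (γ.map (Int.cast : ℤ → ℝ)) i j - (g * k * g⁻¹) i j| ≤ δ}


/-- The standard symplectic form matrix over `ℤ`. -/
def JmatInt : Matrix (Fin 4) (Fin 4) ℤ := !![0, 0, 1, 0; 0, 0, 0, 1; -1, 0, 0, 0; 0, -1, 0, 0]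

lemma JmatInt_map : JmatInt.map (Int.cast : ℤ → ℝ) = Jmat := by
  ext i j
  fin_cases i <;> fin_cases j <;> simp [JmatInt, Jmat]

lemma JmatInt_mul_self : JmatInt * JmatInt = -1 := by
  decide

lemma mem_Smat_iff {m : ℕ} {M : Matrix (Fin 4) (Fin 4) ℤ} :
    M ∈ Smat m ↔ Mᵀ * JmatInt * M = (m : ℤ) • JmatInt := by
  have hinj : Function.Injective
      (fun A : Matrix (Fin 4) (Fin 4) ℤ => A.map (Int.cast : ℤ → ℝ)) :=
    Matrix.map_injective Int.cast_injective
  have hmul (A B : Matrix (Fin 4) (Fin 4) ℤ) : (A * B).map (Int.cast : ℤ → ℝ) =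
      A.map (Int.cast : ℤ → ℝ) * B.map (Int.cast : ℤ → ℝ) :=
    Matrix.map_mul (f := Int.castRingHom ℝ)
  have hsmul : ((m : ℤ) • JmatInt).map (Int.cast : ℤ → ℝ) = (m : ℝ) • Jmat := by
    rw [← JmatInt_map]
    ext i j
    rw [Matrix.map_apply, Matrix.smul_apply, Matrix.smul_apply, Matrix.map_apply]
    push_cast [smul_eq_mul]
    rfl
  rw [← hinj.eq_iff]
  simp only [hmul, hsmul, JmatInt_map]
  rfl

lemma mul_mem_Smat_one {A B : Matrix (Fin 4) (Fin 4) ℤ} (hA : A ∈ Smat 1) (hB : B ∈ Smat 1) :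
    A * B ∈ Smat 1 := by
  rw [mem_Smat_iff] at *
  calc (A * B)ᵀ * JmatInt * (A * B) = Bᵀ * (Aᵀ * JmatInt * A) * B := by
        simp only [Matrix.transpose_mul, Matrix.mul_assoc]
    _ = _ := by rw [hA]; simpa using hB

lemma neg_J_mul_transpose_mul_J_mul {m : ℕ} {B : Matrix (Fin 4) (Fin 4) ℤ} (hB : B ∈ Smat m) :
    -(JmatInt * Bᵀ * JmatInt) * B = (m : ℤ) • 1 := by
  rw [mem_Smat_iff] at hB
  calc -(JmatInt * Bᵀ * JmatInt) * B = -(JmatInt * (Bᵀ * JmatInt * B)) := by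
        simp only [Matrix.neg_mul, Matrix.mul_assoc]
    _ = _ := by rw [hB, Matrix.mul_smul, JmatInt_mul_self, smul_neg, neg_neg]

lemma det_ne_zero_of_mem_Smat {m : ℕ} (hm : 0 < m) {B : Matrix (Fin 4) (Fin 4) ℤ}
    (hB : B ∈ Smat m) : B.det ≠ 0 := by
  intro h
  have := congrArg Matrix.det (neg_J_mul_transpose_mul_J_mul hB)
  rw [Matrix.det_mul, h, mul_zero, Matrix.det_smul, Matrix.det_one, mul_one] at this
  exact pow_ne_zero _ (by exact_mod_cast hm.ne') this.symm

lemma mul_right_cancel_of_det_ne_zero {n : Type*} [Fintype n] [DecidableEq n]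
    {R : Type*} [CommRing R] [IsDomain R] {A B C : Matrix n n R} (hB : B.det ≠ 0)
    (h : A * B = C * B) : A = C := by
  have := congrArg (· * B.adjugate) h
  simp only [Matrix.mul_assoc, Matrix.mul_adjugate, Matrix.mul_smul, Matrix.mul_one] at this
  ext i j
  exact mul_left_cancel₀ hB (congrFun (congrFun this i) j)

/-- Two elements of `S(m)` congruent modulo `m` differ by left multiplication by `Sp₄(ℤ)`. -/
lemma exists_eq_mul_of_map_eq {m : ℕ} (hm : 0 < m) {A B : Matrix (Fin 4) (Fin 4) ℤ}
    (hA : A ∈ Smat m) (hB : B ∈ Smat m)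
    (h : A.map (Int.cast : ℤ → ZMod m) = B.map (Int.cast : ℤ → ZMod m)) :
    ∃ γ ∈ Smat 1, A = γ * B := by
  have hdvd (i j) : (m : ℤ) ∣ A i j - B i j :=
    (ZMod.intCast_eq_intCast_iff_dvd_sub _ _ _).1 (congrFun (congrFun h i) j).symm
  choose X hX using hdvd
  have hAX : A = B + (m : ℤ) • Matrix.of X := by
    ext i j
    simp [← hX i j]
  have hdet := det_ne_zero_of_mem_Smat hm hB
  let γ := 1 + Matrix.of X * -(JmatInt * Bᵀ * JmatInt)
  have hγ : A = γ * B := by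
    simp only [γ]
    rw [Matrix.add_mul, Matrix.one_mul, Matrix.mul_assoc, neg_J_mul_transpose_mul_J_mul hB,
      Matrix.mul_smul, Matrix.mul_one, hAX]
  refine ⟨γ, ?_, hγ⟩
  rw [mem_Smat_iff] at *
  have key : Bᵀ * (γᵀ * JmatInt * γ) * B = Bᵀ * JmatInt * B := by
    rw [hB, ← hA, hγ]
    simp only [Matrix.transpose_mul, Matrix.mul_assoc]
  have key' := mul_right_cancel_of_det_ne_zero hdet key
  rw [Nat.cast_one, one_smul]
  apply Matrix.transpose_injective
  apply mul_right_cancel_of_det_ne_zero hdet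
  simpa only [Matrix.transpose_mul, Matrix.transpose_transpose] using
    congrArg Matrix.transpose key'

lemma orbit_subset_of_eq_mul {A B γ : Matrix (Fin 4) (Fin 4) ℤ} (hγ : γ ∈ Smat 1)
    (h : A = γ * B) : {N | ∃ δ ∈ Smat 1, N = δ * A} ⊆ {N | ∃ δ ∈ Smat 1, N = δ * B} := by
  rintro _ ⟨δ, hδ, rfl⟩
  exact ⟨δ * γ, mul_mem_Smat_one hδ hγ, by rw [h, Matrix.mul_assoc]⟩

theorem finitely_many_left_cosets :
    ∀ m : ℕ, 0 < m →
      {O : Set (Matrix (Fin 4) (Fin 4) ℤ) |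
        ∃ M ∈ Smat m, O = {N | ∃ γ ∈ Smat 1, N = γ * M}}.Finite := by
  intro m hm
  have : NeZero m := ⟨hm.ne'⟩
  refine (Set.finite_iUnion (f := fun c : Matrix (Fin 4) (Fin 4) (ZMod m) =>
    {O : Set (Matrix (Fin 4) (Fin 4) ℤ) | ∃ M ∈ Smat m, M.map (Int.cast : ℤ → ZMod m) = c ∧
      O = {N | ∃ γ ∈ Smat 1, N = γ * M}}) fun c => Set.Subsingleton.finite ?_).subset ?_
  · rintro _ ⟨A, hA, hAc, rfl⟩ _ ⟨B, hB, hBc, rfl⟩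
    obtain ⟨γ, hγ, h⟩ := exists_eq_mul_of_map_eq hm hA hB (hAc.trans hBc.symm)
    obtain ⟨γ', hγ', h'⟩ := exists_eq_mul_of_map_eq hm hB hA (hBc.trans hAc.symm)
    exact (orbit_subset_of_eq_mul hγ h).antisymm (orbit_subset_of_eq_mul hγ' h')
  · rintro O ⟨M, hM, hO⟩
    exact Set.mem_iUnion.2 ⟨_, M, hM, rfl, hO⟩
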